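/- arXiv:1703.06392 — 6 statements merged into one kernel-verified Lean document; each statement's English description precedes it below -/
import Mathlib

section
/- Let B = (𝓑_i)_{i∈S} be a collection of finite nonempty subsets of ℤ^n and let I, J ⊆ S with K = I ∩ J. Then def(I ∪ J) ≤ def(I) + def(J) − def(K). -/
noncomputable section

/-- `L(J)`: the `ℝ`-linear span of all differences `a - b` with `a, b ∈ B i` for some `i ∈ J`. -/
def colSpan {ι V : Type*} [AddCommGroup V] [Module ℝ V]
    (B : ι → Set V) (J : Set ι) : Submodule ℝ V :=
  Submodule.span ℝ {v | ∃ i ∈ J, ∃ a ∈ B i, ∃ b ∈ B i, v = a - b}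

/-- The defect `def(J) = dim L(J) - |J|`. -/
def colDefect {ι V : Type*} [AddCommGroup V] [Module ℝ V]
    (B : ι → Set V) (J : Finset ι) : ℤ :=
  (Module.finrank ℝ (colSpan B (J : Set ι)) : ℤ) - (J.card : ℤ)

/-- The minimal defect `min_{J ⊆ S} def(J)` over all subsets of `S` (including `∅`). -/
def colMinDefectOn {ι V : Type*} [AddCommGroup V] [Module ℝ V]
    (B : ι → Set V) (S : Finset ι) : ℤ :=
  S.powerset.inf' ⟨∅, Finset.empty_mem_powerset S⟩ (fun J => colDefect B J)

/-- A finite subset of `ℤ^n` viewed inside `ℝ^n`. -/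
def realize {n : ℕ} (A : Finset (Fin n → ℤ)) : Set (Fin n → ℝ) :=
  (fun a : Fin n → ℤ => fun j => (a j : ℝ)) '' (A : Set (Fin n → ℤ))

theorem colSpan_union {ι V : Type*} [AddCommGroup V] [Module ℝ V]
    (B : ι → Set V) (I J : Set ι) : colSpan B (I ∪ J) = colSpan B I ⊔ colSpan B J := by
  rw [colSpan, colSpan, colSpan, ← Submodule.span_union]
  congr 1
  ext v
  simp only [Set.mem_union, Set.mem_ofPred_eq, or_and_right, exists_or]

theorem colSpan_mono {ι V : Type*} [AddCommGroup V] [Module ℝ V]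
    (B : ι → Set V) {I J : Set ι} (h : I ⊆ J) : colSpan B I ≤ colSpan B J :=
  Submodule.span_mono fun _ ⟨i, hi, hv⟩ => ⟨i, h hi, hv⟩

theorem colDefect_union_le {ι V : Type*} [DecidableEq ι] [AddCommGroup V] [Module ℝ V]
    [FiniteDimensional ℝ V] (B : ι → Set V) (I J : Finset ι) :
    colDefect B (I ∪ J) ≤ colDefect B I + colDefect B J - colDefect B (I ∩ J) := by
  have hdim := Submodule.finrank_sup_add_finrank_inf_eq (colSpan B (I : Set ι)) (colSpan B J)
  rw [← colSpan_union, ← Finset.coe_union] at hdim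
  have hinf : Module.finrank ℝ (colSpan B ((I : Set ι) ∩ J)) ≤
      Module.finrank ℝ (colSpan B (I : Set ι) ⊓ colSpan B (J : Set ι) : Submodule ℝ V) :=
    Submodule.finrank_mono <|
      le_inf (colSpan_mono B Set.inter_subset_left) (colSpan_mono B Set.inter_subset_right)
  have hcard := Finset.card_union_add_card_inter I J
  rw [← Finset.coe_inter] at hinf
  simp only [colDefect]
  omega

/-- For `I, J ⊆ S` with `K = I ∩ J`,
`def(I ∪ J) ≤ def(I) + def(J) − def(K)`. -/
theorem defect_union_le {n : ℕ} (hn : 1 ≤ n) {ι : Type*} [Fintype ι] [DecidableEq ι]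
    (B : ι → Finset (Fin n → ℤ)) (hB : ∀ i, (B i).Nonempty) (I J : Finset ι) :
    colDefect (fun i => realize (B i)) (I ∪ J) ≤
      colDefect (fun i => realize (B i)) I + colDefect (fun i => realize (B i)) J -
        colDefect (fun i => realize (B i)) (I ∩ J) :=
  colDefect_union_le _ I J
end
end

section
/- Let B = (𝓑_i)_{i∈S} be a collection of finite nonempty subsets of ℤ^n. Then there exists exactly one essential subset of S, i.e., exactly one subset J ⊆ S that is minimal by inclusion among subsets whose defect equals the minimal defect d(B). (When d(B) = 0 this unique essential subset is the empty set.) -/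
noncomputable section

/-- The defect is submodular. -/
theorem colDefect_union_add_inter_le {ι V : Type*} [DecidableEq ι] [AddCommGroup V] [Module ℝ V]
    [FiniteDimensional ℝ V] (B : ι → Set V) (I J : Finset ι) :
    colDefect B (I ∪ J) + colDefect B (I ∩ J) ≤ colDefect B I + colDefect B J := by
  have hdim := Submodule.finrank_sup_add_finrank_inf_eq (colSpan B (I : Set ι)) (colSpan B J)
  have hinter : Module.finrank ℝ (colSpan B ((I : Set ι) ∩ J)) ≤
      Module.finrank ℝ ↥(colSpan B (I : Set ι) ⊓ colSpan B J) :=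
    Submodule.finrank_mono
      (le_inf (colSpan_mono B Set.inter_subset_left) (colSpan_mono B Set.inter_subset_right))
  have hcard := Finset.card_union_add_card_inter I J
  rw [← colSpan_union, ← Finset.coe_union] at hdim
  rw [← Finset.coe_inter] at hinter
  unfold colDefect
  lia

theorem colMinDefectOn_le {ι V : Type*} [AddCommGroup V] [Module ℝ V] (B : ι → Set V)
    {S J : Finset ι} (h : J ⊆ S) : colMinDefectOn B S ≤ colDefect B J :=
  Finset.inf'_le _ (Finset.mem_powerset.2 h)

theorem exists_colDefect_eq_colMinDefectOn {ι V : Type*} [AddCommGroup V] [Module ℝ V]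
    (B : ι → Set V) (S : Finset ι) : ∃ J ⊆ S, colDefect B J = colMinDefectOn B S := by
  obtain ⟨J, hJ, h⟩ := Finset.exists_mem_eq_inf'
    ⟨∅, Finset.empty_mem_powerset S⟩ (fun J => colDefect B J)
  exact ⟨J, Finset.mem_powerset.1 hJ, h.symm⟩

/-- There is exactly one essential subset: exactly one subset `J ⊆ S` whose
defect equals the minimal defect `d(B)` and which is minimal by inclusion with this property. -/
theorem essential_existsUnique {n : ℕ} (hn : 1 ≤ n) {ι : Type*} [Fintype ι] [DecidableEq ι]
    (B : ι → Finset (Fin n → ℤ)) (hB : ∀ i, (B i).Nonempty) :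
    ∃! J : Finset ι,
      colDefect (fun i => realize (B i)) J =
        colMinDefectOn (fun i => realize (B i)) Finset.univ ∧
      ∀ I : Finset ι, I ⊂ J →
        colMinDefectOn (fun i => realize (B i)) Finset.univ <
          colDefect (fun i => realize (B i)) I := by
  set C : ι → Set (Fin n → ℝ) := fun i => realize (B i)
  have hle (J : Finset ι) : colMinDefectOn C Finset.univ ≤ colDefect C J :=
    colMinDefectOn_le C (Finset.subset_univ J)
  obtain ⟨J₀, -, hJ₀⟩ := exists_colDefect_eq_colMinDefectOn C Finset.univ
  obtain ⟨J, hJ, hmin⟩ := wellFounded_lt.has_min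
    {J : Finset ι | colDefect C J = colMinDefectOn C Finset.univ} ⟨J₀, hJ₀⟩
  refine ⟨J, ⟨hJ, fun I hI => (hle I).lt_of_ne fun h => hmin I h.symm hI⟩, ?_⟩
  rintro K ⟨hK, hKmin⟩
  have hJ' : colDefect C J = colMinDefectOn C Finset.univ := hJ
  have hinter : colDefect C (K ∩ J) = colMinDefectOn C Finset.univ := by
    have hsub := colDefect_union_add_inter_le C K J
    linarith [hle (K ∪ J), hle (K ∩ J)]
  have hKeq : K ∩ J = K := by
    by_contra hne
    exact (hKmin _ (Finset.inter_subset_left.ssubset_of_ne hne)).ne' hinter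
  have hJeq : K ∩ J = J := by
    by_contra hne
    exact hmin _ hinter (Finset.inter_subset_right.ssubset_of_ne hne)
  exact hKeq.symm.trans hJeq
end
end

section
/- Let B = (𝓑_i)_{i∈S} be a collection of finite nonempty subsets of ℤ^n and let J ⊆ S be the unique essential subset of B, with complement J^c = S ∖ J. Then the minimal defect of the projected collection (π_J(𝓑_i))_{i∈J^c}, computed in ℝ^n/L(J), equals 0. -/
noncomputable section

/-- The projected collection `(π_J(B_i))_i` inside `ℝ^n / L(J)`. -/
def projColl {ι : Type*} {n : ℕ} (B : ι → Set (Fin n → ℝ)) (J : Set ι) :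
    ι → Set ((Fin n → ℝ) ⧸ colSpan B J) :=
  fun i => (colSpan B J).mkQ '' B i

theorem map_colSpan {ι V W : Type*} [AddCommGroup V] [Module ℝ V] [AddCommGroup W] [Module ℝ W]
    (f : V →ₗ[ℝ] W) (B : ι → Set V) (I : Set ι) :
    colSpan (fun i => f '' B i) I = (colSpan B I).map f := by
  rw [colSpan, colSpan, Submodule.map_span]
  congr 1
  ext w
  constructor
  · rintro ⟨i, hi, _, ⟨a, ha, rfl⟩, _, ⟨b, hb, rfl⟩, rfl⟩
    exact ⟨a - b, ⟨i, hi, a, ha, b, hb, rfl⟩, map_sub f a b⟩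
  · rintro ⟨_, ⟨i, hi, a, ha, b, hb, rfl⟩, rfl⟩
    exact ⟨i, hi, f a, ⟨a, ha, rfl⟩, f b, ⟨b, hb, rfl⟩, map_sub f a b⟩

theorem finrank_map_mkQ_add_finrank {V : Type*} [AddCommGroup V] [Module ℝ V]
    [FiniteDimensional ℝ V] (p q : Submodule ℝ V) :
    Module.finrank ℝ (p.map q.mkQ) + Module.finrank ℝ q =
      Module.finrank ℝ (p ⊔ q : Submodule ℝ V) := by
  have h₁ := (q.mkQ.domRestrict p).finrank_range_add_finrank_ker
  rw [LinearMap.range_domRestrict, LinearMap.ker_domRestrict, Submodule.ker_mkQ] at h₁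
  have h₂ : Module.finrank ℝ (q.submoduleOf p) = Module.finrank ℝ (p ⊓ q : Submodule ℝ V) := by
    rw [← Submodule.finrank_map_subtype_eq, Submodule.submoduleOf, Submodule.map_comap_subtype]
  have h₃ := Submodule.finrank_sup_add_finrank_inf_eq p q
  rw [show Module.finrank ℝ (q.comap p.subtype) = _ from h₂] at h₁
  omega

/-- Projecting along `L(J)` subtracts the defect of `J`. -/
theorem colDefect_projColl {ι : Type*} [DecidableEq ι] {n : ℕ} (B : ι → Set (Fin n → ℝ))
    {I J : Finset ι} (hIJ : Disjoint I J) :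
    colDefect (projColl B (J : Set ι)) I = colDefect B (I ∪ J) - colDefect B J := by
  have h := finrank_map_mkQ_add_finrank (colSpan B (I : Set ι)) (colSpan B (J : Set ι))
  rw [← colSpan_union, ← map_colSpan, ← Finset.coe_union] at h
  change Module.finrank ℝ (colSpan (projColl B (J : Set ι)) (I : Set ι)) + _ = _ at h
  rw [colDefect, colDefect, colDefect, Finset.card_union_of_disjoint hIJ]
  omega

/-- If `J` is the (unique) essential subset of `B`, then the minimal defect of
the projected collection `(π_J(B_i))_{i ∈ J^c}` inside `ℝ^n / L(J)` is `0`. -/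
theorem minDefect_proj_essential {n : ℕ} (hn : 1 ≤ n) {ι : Type*} [Fintype ι] [DecidableEq ι]
    (B : ι → Finset (Fin n → ℤ)) (hB : ∀ i, (B i).Nonempty) (J : Finset ι)
    (hJ : colDefect (fun i => realize (B i)) J =
      colMinDefectOn (fun i => realize (B i)) Finset.univ)
    (hJmin : ∀ I : Finset ι, I ⊂ J →
      colMinDefectOn (fun i => realize (B i)) Finset.univ <
        colDefect (fun i => realize (B i)) I) :
    colMinDefectOn (projColl (fun i => realize (B i)) (J : Set ι)) (Finset.univ \ J) = 0 := by
  refine le_antisymm ?_ (Finset.le_inf' _ _ fun I hI => ?_)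
  · refine (Finset.inf'_le _ (Finset.empty_mem_powerset _)).trans ?_
    rw [colDefect_projColl _ (Finset.disjoint_empty_left J), Finset.empty_union, sub_self]
  · rw [Finset.mem_powerset] at hI
    rw [colDefect_projColl _ (Finset.disjoint_of_subset_left hI Finset.sdiff_disjoint),
      sub_nonneg, hJ]
    exact Finset.inf'_le _ (Finset.mem_powerset.mpr (Finset.subset_univ _))
end
end

section
/- Let A = (𝒜_1, …, 𝒜_k) be a collection of finite nonempty subsets of ℤ^n. Then the set of consistency X_A ⊆ Ω_A is irreducible in the following sense: for any two polynomial functions F, G on Ω_A, if the product F·G vanishes at every point of X_A, then either F vanishes at every point of X_A or G vanishes at every point of X_A. -/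
noncomputable section

/-- The monomial `p^a = ∏_j p_j^{a_j}` as an element of `ℂˣ`. -/
def mon {n : ℕ} (p : Fin n → ℂˣ) (a : Fin n → ℤ) : ℂˣ :=
  ∏ j, p j ^ a j

/-- Evaluation of a Laurent polynomial `f` with support in `A` at `p ∈ (ℂ*)^n`:
`f(p) = ∑_{a ∈ A} f_a · p^a`. -/
def evalL {n : ℕ} {A : Finset (Fin n → ℤ)} (f : {x // x ∈ A} → ℂ) (p : Fin n → ℂˣ) : ℂ :=
  ∑ a : {x // x ∈ A}, f a * (mon p a.1 : ℂ)

/-- The point `(exp L₁, …, exp Lₙ)` of the torus `(ℂ*)^n`. -/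
def expPoint {n : ℕ} (L : Fin n → ℂ) : Fin n → ℂˣ :=
  fun j => Units.mk0 (Complex.exp (L j)) (Complex.exp_ne_zero _)

theorem mon_expPoint {n : ℕ} (L : Fin n → ℂ) (a : Fin n → ℤ) :
    (mon (expPoint L) a : ℂ) = Complex.exp (∑ j, a j * L j) := by
  simp [mon, expPoint, Complex.exp_sum, Complex.exp_int_mul]

theorem exists_expPoint_eq {n : ℕ} (p : Fin n → ℂˣ) : ∃ L : Fin n → ℂ, expPoint L = p :=
  ⟨fun j => Complex.log (p j), funext fun j => Units.ext (Complex.exp_log (p j).ne_zero)⟩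

/-- Change the coefficient of `f` at `b` so that the result vanishes at `p`. -/
def forceZero {n : ℕ} {A : Finset (Fin n → ℤ)} (b : {x // x ∈ A})
    (f : {x // x ∈ A} → ℂ) (p : Fin n → ℂˣ) : {x // x ∈ A} → ℂ :=
  fun a => f a - if a = b then evalL f p * (mon p b.1 : ℂ)⁻¹ else 0

theorem evalL_forceZero {n : ℕ} {A : Finset (Fin n → ℤ)} (b : {x // x ∈ A})
    (f : {x // x ∈ A} → ℂ) (p : Fin n → ℂˣ) : evalL (forceZero b f p) p = 0 := by
  have h : evalL (forceZero b f p) p = evalL f p -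
      evalL f p * (mon p b.1 : ℂ)⁻¹ * (mon p b.1 : ℂ) := by
    simp only [evalL, forceZero, sub_mul, ite_mul, zero_mul, Finset.sum_sub_distrib,
      Finset.sum_ite_eq', Finset.mem_univ, if_true]
  rw [h, inv_mul_cancel_right₀ (Units.ne_zero _), sub_self]

theorem forceZero_eq_self {n : ℕ} {A : Finset (Fin n → ℤ)} (b : {x // x ∈ A})
    (f : {x // x ∈ A} → ℂ) (p : Fin n → ℂˣ) (h : evalL f p = 0) : forceZero b f p = f := by
  funext a
  simp [forceZero, h]

theorem differentiable_forceZero {n : ℕ} {A : Finset (Fin n → ℤ)} (b a : {x // x ∈ A})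
    {f : ℂ → {x // x ∈ A} → ℂ} {L : ℂ → Fin n → ℂ}
    (hf : ∀ a, Differentiable ℂ fun t => f t a) (hL : ∀ j, Differentiable ℂ fun t => L t j) :
    Differentiable ℂ fun t => forceZero b (f t) (expPoint (L t)) a := by
  simp only [forceZero, evalL, mon_expPoint, ← Complex.exp_neg]
  split_ifs <;> fun_prop

theorem differentiable_mvPolynomial_eval {σ : Type*} (F : MvPolynomial σ ℂ) {x : ℂ → σ → ℂ}
    (hx : ∀ v, Differentiable ℂ fun t => x t v) :
    Differentiable ℂ fun t => MvPolynomial.eval (x t) F := by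
  induction F using MvPolynomial.induction_on with
  | C c => simp
  | add p q hp hq => simpa only [map_add] using hp.fun_add hq
  | mul_X p v hp => simpa only [map_mul, MvPolynomial.eval_X] using hp.fun_mul (hx v)

theorem eq_zero_or_eq_zero_of_differentiable_of_mul_eq_zero {u v : ℂ → ℂ}
    (hu : Differentiable ℂ u) (hv : Differentiable ℂ v) (h : ∀ t, u t * v t = 0) :
    (∀ t, u t = 0) ∨ ∀ t, v t = 0 := by
  have := AnalyticOnNhd.eq_zero_or_eq_zero_of_mul_eq_zero (f := u) (g := v)
    (U := Set.univ) (fun t _ => hu.analyticAt t) (fun t _ => hv.analyticAt t)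
    (fun t _ => h t) isPreconnected_univ
  simpa using this

/-- The set of consistency `X_A` is irreducible: if a product of two
polynomial functions on `Ω_A` vanishes on `X_A`, then one of the factors vanishes on `X_A`. -/
theorem consistency_set_irreducible {n k : ℕ} (hn : 1 ≤ n)
    (A : Fin k → Finset (Fin n → ℤ)) (hA : ∀ i, (A i).Nonempty)
    (F G : MvPolynomial ((i : Fin k) × {x // x ∈ A i}) ℂ)
    (hFG : ∀ f : ∀ i, {x // x ∈ A i} → ℂ,
      (∃ p : Fin n → ℂˣ, ∀ i, evalL (f i) p = 0) →
        MvPolynomial.eval (fun v => f v.1 v.2) (F * G) = 0) :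
    (∀ f : ∀ i, {x // x ∈ A i} → ℂ,
      (∃ p : Fin n → ℂˣ, ∀ i, evalL (f i) p = 0) →
        MvPolynomial.eval (fun v => f v.1 v.2) F = 0) ∨
    (∀ f : ∀ i, {x // x ∈ A i} → ℂ,
      (∃ p : Fin n → ℂˣ, ∀ i, evalL (f i) p = 0) →
        MvPolynomial.eval (fun v => f v.1 v.2) G = 0) := by
  by_contra! hne
  obtain ⟨⟨x, ⟨p, hp⟩, hx⟩, ⟨y, ⟨q, hq⟩, hy⟩⟩ := hne
  obtain ⟨L, rfl⟩ := exists_expPoint_eq p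
  obtain ⟨M, rfl⟩ := exists_expPoint_eq q
  choose b hb using hA
  let P : ℂ → Fin n → ℂ := fun t j => (1 - t) * L j + t * M j
  let z : ℂ → ∀ i, {a // a ∈ A i} → ℂ := fun t i =>
    forceZero ⟨b i, hb i⟩ (fun a => (1 - t) * x i a + t * y i a) (expPoint (P t))
  have hP0 : P 0 = L := by simp [P]
  have hP1 : P 1 = M := by simp [P]
  have hz0 : z 0 = x := by
    funext i
    simpa [z, hP0] using forceZero_eq_self ⟨b i, hb i⟩ (x i) (expPoint L) (hp i)
  have hz1 : z 1 = y := by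
    funext i
    simpa [z, hP1] using forceZero_eq_self ⟨b i, hb i⟩ (y i) (expPoint M) (hq i)
  have hz : ∀ v : (i : Fin k) × {a // a ∈ A i}, Differentiable ℂ fun t => z t v.1 v.2 :=
    fun v => differentiable_forceZero _ _ (fun _ => by fun_prop) (fun _ => by fun_prop)
  have hmul : ∀ t, MvPolynomial.eval (fun v => z t v.1 v.2) F *
      MvPolynomial.eval (fun v => z t v.1 v.2) G = 0 := fun t => by
    rw [← map_mul]
    exact hFG (z t) ⟨expPoint (P t), fun i => evalL_forceZero _ _ _⟩
  rcases eq_zero_or_eq_zero_of_differentiable_of_mul_eq_zero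
      (differentiable_mvPolynomial_eval F hz) (differentiable_mvPolynomial_eval G hz)
      hmul with h | h
  · exact hx (hz0 ▸ h 0)
  · exact hy (hz1 ▸ h 1)
end
end

section
/- Let A = (𝒜_1, …, 𝒜_n) be a collection of n finite nonempty subsets of ℤ^n and let G ⊆ (ℂ*)^n be a finite subgroup such that G ∩ ker(G(A)) = {1}. Then there exists a nonzero polynomial function F on Ω_A such that every f = (f_1, …, f_n) ∈ Ω_A having two distinct common zeros p, q ∈ (ℂ*)^n with p·q^{-1} ∈ G satisfies F(f) = 0. -/
noncomputable section

/-- `t ∈ ker(G(A))`: every difference of two points of one of the supports takes value `1`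
at `t`. -/
def inKer {n k : ℕ} (A : Fin k → Finset (Fin n → ℤ)) (t : Fin n → ℂˣ) : Prop :=
  ∀ i, ∀ a ∈ A i, ∀ b ∈ A i, mon t (a - b) = 1

/-- More polynomials than variables are algebraically dependent. -/
theorem MvPolynomial.exists_ne_zero_aeval_eq_zero {K ι σ : Type*} [Field K] [Fintype ι] [Fintype σ]
    (h : Fintype.card σ < Fintype.card ι) (φ : ι → MvPolynomial σ K) :
    ∃ F : MvPolynomial ι K, F ≠ 0 ∧ MvPolynomial.aeval φ F = 0 := by
  have hφ : ¬ AlgebraicIndependent K φ := by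
    intro hφ
    have := hφ.lift_cardinalMk_le_trdeg
    rw [MvPolynomial.trdeg_of_isDomain] at this
    simp only [Cardinal.mk_fintype, Cardinal.lift_natCast, Nat.cast_le] at this
    omega
  rw [algebraicIndependent_iff] at hφ
  push Not at hφ
  obtain ⟨F, hF, hF0⟩ := hφ
  exact ⟨F, hF0, hF⟩

theorem mon_mul {n : ℕ} (p q : Fin n → ℂˣ) (a : Fin n → ℤ) :
    mon (p * q) a = mon p a * mon q a := by
  simp [mon, mul_zpow, Finset.prod_mul_distrib]

theorem mon_sub {n : ℕ} (p : Fin n → ℂˣ) (a b : Fin n → ℤ) :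
    mon p (a - b) = mon p a / mon p b := by
  simp [mon, zpow_sub, Finset.prod_mul_distrib, div_eq_mul_inv]

/-- The sums over each block of the index set, together with a weighted sum over the block `i₀`. -/
def blockSums {ι : Type*} [Fintype ι] {B : ι → Type*} [∀ i, Fintype (B i)] (i₀ : ι)
    (w : B i₀ → ℂ) : (((i : ι) × B i) → ℂ) →ₗ[ℂ] (ι → ℂ) × ℂ where
  toFun g := (fun i => ∑ a, g ⟨i, a⟩, ∑ a, w a * g ⟨i₀, a⟩)
  map_add' g h := by
    ext <;> simp [Finset.sum_add_distrib, mul_add]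
  map_smul' c g := by
    ext <;> simp [Finset.mul_sum, mul_left_comm]

theorem blockSums_surjective {ι : Type*} [Fintype ι] {B : ι → Type*} [∀ i, Fintype (B i)]
    (hB : ∀ i, Nonempty (B i)) (i₀ : ι) (w : B i₀ → ℂ) {a b : B i₀} (hab : w a ≠ w b) :
    Function.Surjective (blockSums i₀ w) := by
  classical
  rintro ⟨y, z⟩
  let c := fun i => (hB i).some
  have hw : w a - w b ≠ 0 := sub_ne_zero.mpr hab
  set s : ℂ := (z - w b * y i₀) / (w a - w b) with hs
  let h : ∀ i, B i → ℂ := Function.update (fun i => Pi.single (c i) (y i)) i₀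
    (Pi.single a s + Pi.single b (y i₀ - s))
  have h₀ : h i₀ = Pi.single a s + Pi.single b (y i₀ - s) := Function.update_self ..
  refine ⟨fun v => h v.1 v.2, Prod.ext (funext fun i => ?_) ?_⟩
  · change ∑ x, h i x = y i
    by_cases hi : i = i₀
    · subst hi
      simp [h₀, Finset.sum_add_distrib]
    · simp [h, Function.update_of_ne hi]
  · change ∑ x, w x * h i₀ x = z
    simp only [h₀, Pi.add_apply, mul_add, Finset.sum_add_distrib, Pi.single_apply, mul_ite,
      mul_zero, Finset.sum_ite_eq', Finset.mem_univ, if_true]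
    rw [hs]
    field_simp
    ring

/-- If `t` separates two points of some support, the systems vanishing at two points with ratio `t`
lie in a hypersurface. -/
theorem exists_ne_zero_eval_eq_zero_of_mon_ne {n : ℕ} (A : Fin n → Finset (Fin n → ℤ))
    (hA : ∀ i, (A i).Nonempty) (t : Fin n → ℂˣ) {i₀ : Fin n} {a b : Fin n → ℤ}
    (ha : a ∈ A i₀) (hb : b ∈ A i₀) (hab : mon t a ≠ mon t b) :
    ∃ F : MvPolynomial ((i : Fin n) × {x // x ∈ A i}) ℂ, F ≠ 0 ∧
      ∀ (f : ∀ i, {x // x ∈ A i} → ℂ) (q : Fin n → ℂˣ),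
        (∀ i, evalL (f i) (t * q) = 0) → (∀ i, evalL (f i) q = 0) →
        MvPolynomial.eval (fun v => f v.1 v.2) F = 0 := by
  let L := blockSums (B := fun i => {x // x ∈ A i}) i₀ (fun x => (mon t x.1 : ℂ))
  have hL : Function.Surjective L :=
    blockSums_surjective (fun i => (hA i).to_subtype) i₀ _ (a := ⟨a, ha⟩) (b := ⟨b, hb⟩)
      (fun h => hab (Units.ext h))
  have hdim : n + 1 + Module.finrank ℂ (LinearMap.ker L) =
      Fintype.card ((i : Fin n) × {x // x ∈ A i}) := by
    have := L.finrank_range_add_finrank_ker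
    rw [LinearMap.range_eq_top.mpr hL, finrank_top] at this
    simpa using this
  let e := Module.finBasis ℂ (LinearMap.ker L)
  obtain ⟨M, hM⟩ : ∃ M : ℤ, ∀ v : (i : Fin n) × {x // x ∈ A i}, ∀ j, v.2.1 j ≤ M := by
    obtain ⟨M, hM⟩ := (Set.finite_range
      fun x : ((i : Fin n) × {x // x ∈ A i}) × Fin n => x.1.2.1 x.2).bddAbove
    exact ⟨M, fun v j => hM ⟨(v, j), rfl⟩⟩
  let φ : (i : Fin n) × {x // x ∈ A i} →
      MvPolynomial (Fin n ⊕ Fin (Module.finrank ℂ (LinearMap.ker L))) ℂ := fun v =>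
    (∑ k, MvPolynomial.C ((e k).1 v) * MvPolynomial.X (Sum.inr k)) *
      ∏ j, MvPolynomial.X (Sum.inl j) ^ (M - v.2.1 j).toNat
  obtain ⟨F, hF, hφ⟩ := MvPolynomial.exists_ne_zero_aeval_eq_zero (by simp [← hdim]) φ
  refine ⟨F, hF, fun f q hp hq => ?_⟩
  set m : ℂˣ := mon q fun _ => M with hm
  let g : ((i : Fin n) × {x // x ∈ A i}) → ℂ := fun v => f v.1 v.2 * mon q v.2.1 * (m⁻¹ : ℂˣ)
  have hg : g ∈ LinearMap.ker L := by
    refine Prod.ext (funext fun i => ?_) ?_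
    · change ∑ x, f i x * mon q x.1 * (m⁻¹ : ℂˣ) = 0
      rw [← Finset.sum_mul]
      exact mul_eq_zero_of_left (hq i) _
    · change ∑ x : {x // x ∈ A i₀}, (mon t x.1 : ℂ) * (f i₀ x * mon q x.1 * (m⁻¹ : ℂˣ)) = 0
      have h := hp i₀
      simp only [evalL, mon_mul, Units.val_mul] at h
      rw [← mul_eq_zero_of_left h ((m⁻¹ : ℂˣ) : ℂ), Finset.sum_mul]
      exact Finset.sum_congr rfl fun x _ => by ring
  let x : Fin n ⊕ Fin (Module.finrank ℂ (LinearMap.ker L)) → ℂ :=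
    Sum.elim (fun j => q j) (e.repr ⟨g, hg⟩)
  have hx : (fun v => MvPolynomial.eval x (φ v)) = fun v => f v.1 v.2 := by
    funext v
    have hsum : ∑ k, (e k).1 v * e.repr ⟨g, hg⟩ k = g v := by
      have := congrArg (fun y : LinearMap.ker L => y.1 v) (e.sum_repr ⟨g, hg⟩)
      simpa only [Submodule.coe_sum, Finset.sum_apply, Submodule.coe_smul, Pi.smul_apply,
        smul_eq_mul, mul_comm] using this
    have hprod : ∏ j, (q j : ℂ) ^ (M - v.2.1 j).toNat = ((m / mon q v.2.1 : ℂˣ) : ℂ) := by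
      rw [hm, ← mon_sub, mon, Units.coe_prod]
      refine Finset.prod_congr rfl fun j _ => ?_
      rw [← Units.val_pow_eq_pow_val, ← zpow_natCast,
        Int.toNat_of_nonneg (sub_nonneg.mpr (hM v j)), Pi.sub_apply]
    simp only [φ, x, map_mul, map_sum, map_prod, map_pow, MvPolynomial.eval_C,
      MvPolynomial.eval_X, Sum.elim_inl, Sum.elim_inr, hsum, hprod, g]
    rw [mul_assoc, mul_assoc, ← Units.val_mul, ← Units.val_mul,
      show mon q v.2.1 * (m⁻¹ * (m / mon q v.2.1)) = 1 by simp [div_eq_mul_inv],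
      Units.val_one, mul_one]
  rw [← hx]
  have h := congrArg (MvPolynomial.eval x) hφ
  rw [map_zero, MvPolynomial.aeval_def, MvPolynomial.eval₂_eq', map_sum] at h
  rw [MvPolynomial.eval_eq']
  simpa using h

/-- If `G ⊆ (ℂ*)^n` is a finite subgroup with `G ∩ ker(G(A)) = {1}`, then the
systems having two distinct common roots differing by an element of `G` lie in a proper
algebraic subset of `Ω_A`. -/
theorem finite_group_independence {n : ℕ} (hn : 1 ≤ n)
    (A : Fin n → Finset (Fin n → ℤ)) (hA : ∀ i, (A i).Nonempty)
    (G : Subgroup (Fin n → ℂˣ)) (hGfin : (G : Set (Fin n → ℂˣ)).Finite)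
    (hker : ∀ t ∈ G, inKer A t → t = 1) :
    ∃ F : MvPolynomial ((i : Fin n) × {x // x ∈ A i}) ℂ, F ≠ 0 ∧
      ∀ f : ∀ i, {x // x ∈ A i} → ℂ,
        (∃ p q : Fin n → ℂˣ, p ≠ q ∧ p * q⁻¹ ∈ G ∧
          (∀ i, evalL (f i) p = 0) ∧ (∀ i, evalL (f i) q = 0)) →
        MvPolynomial.eval (fun v => f v.1 v.2) F = 0 := by
  classical
  have hsep : ∀ t : G, t ≠ 1 →
      ∃ F : MvPolynomial ((i : Fin n) × {x // x ∈ A i}) ℂ, F ≠ 0 ∧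
        ∀ (f : ∀ i, {x // x ∈ A i} → ℂ) (q : Fin n → ℂˣ),
          (∀ i, evalL (f i) (t.1 * q) = 0) → (∀ i, evalL (f i) q = 0) →
          MvPolynomial.eval (fun v => f v.1 v.2) F = 0 := by
    intro t ht
    have hnot : ¬ inKer A t.1 := fun h => ht (Subtype.ext (hker t.1 t.2 h))
    simp only [inKer, mon_sub, div_eq_one] at hnot
    push Not at hnot
    obtain ⟨i₀, a, ha, b, hb, hab⟩ := hnot
    exact exists_ne_zero_eval_eq_zero_of_mon_ne A hA t.1 ha hb hab
  choose! F hF hFz using hsep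
  have : Fintype G := hGfin.fintype
  refine ⟨∏ t ∈ Finset.univ.erase (1 : G), F t,
    Finset.prod_ne_zero_iff.mpr fun t ht => hF t (Finset.ne_of_mem_erase ht), ?_⟩
  rintro f ⟨p, q, hpq, hG, hp, hq⟩
  have ht : (⟨p * q⁻¹, hG⟩ : G) ≠ 1 := fun h => hpq (mul_inv_eq_one.mp (congrArg Subtype.val h))
  rw [map_prod]
  exact Finset.prod_eq_zero (Finset.mem_erase.mpr ⟨ht, Finset.mem_univ _⟩)
    (hFz _ ht f q (by simpa using hp) hq)
end
end

section
/- Let A = (𝒜_1, …, 𝒜_n) be a collection of n finite nonempty subsets of ℤ^n such that G(A) = ℤ^n and def(J) > 0 for every proper nonempty subset J ⊊ {1, …, n}, and let m ∈ ℤ^n with m ≠ 0 (defining the nontrivial character χ(x) = x^m = ∏_j x_j^{m_j} on (ℂ*)^n). Then there exists a nonzero polynomial function F on Ω_A such that every f = (f_1, …, f_n) ∈ Ω_A having two distinct common zeros p, q ∈ (ℂ*)^n with p^m = q^m satisfies F(f) = 0. -/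
noncomputable section

open scoped IntermediateField.algebraAdjoinAdjoin in
/-- A finite family of algebraically independent elements, all algebraic over the field generated
by a finite set, has at most as many members as that set. -/
theorem AlgebraicIndependent.card_le_of_mem_algebraicClosure {k K ι : Type*} [Field k] [Field K]
    [Algebra k K] [Fintype ι] {x : ι → K} (hx : AlgebraicIndependent k x) (s : Finset K)
    (h : ∀ i, x i ∈ algebraicClosure (IntermediateField.adjoin k (s : Set K)) K) :
    Fintype.card ι ≤ s.card := by
  have hsub : Set.range x ⊆ (AlgebraicIndependent.matroid k K).closure s := by
    rintro _ ⟨i, rfl⟩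
    rw [AlgebraicIndependent.matroid_closure_eq, SetLike.mem_coe, Subalgebra.mem_algebraicClosure]
    exact (IsFractionRing.isAlgebraic_iff (Algebra.adjoin k (s : Set K))
      (IntermediateField.adjoin k (s : Set K)) K).mpr (mem_algebraicClosure_iff.mp (h i))
  have hind : (AlgebraicIndependent.matroid k K).Indep (Set.range x) :=
    AlgebraicIndependent.matroid_indep_iff.mpr hx.coe_range
  have h1 := hind.encard_le_eRk_of_subset hsub
  rw [Matroid.eRk_closure_eq] at h1
  have h2 := h1.trans (Matroid.eRk_le_encard _ _)
  rw [Set.encard_coe_eq_coe_finsetCard, ← Set.image_univ, hx.injective.encard_image,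
    Set.encard_univ, ENat.card_eq_coe_fintype_card] at h2
  exact_mod_cast h2

section LaurentMonomial

variable {G : Type*} [CommGroup G] {n : ℕ}

/-- The Laurent monomial `t ^ v = ∏ j, t j ^ v j` in a commutative group. -/
def laurentMonomial (t : Fin n → G) (v : Fin n → ℤ) : G :=
  ∏ j, t j ^ v j

theorem laurentMonomial_zero (t : Fin n → G) : laurentMonomial t 0 = 1 := by
  simp [laurentMonomial]

theorem laurentMonomial_add (t : Fin n → G) (v w : Fin n → ℤ) :
    laurentMonomial t (v + w) = laurentMonomial t v * laurentMonomial t w := by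
  simp [laurentMonomial, zpow_add, Finset.prod_mul_distrib]

theorem laurentMonomial_neg (t : Fin n → G) (v : Fin n → ℤ) :
    laurentMonomial t (-v) = (laurentMonomial t v)⁻¹ := by
  simp [laurentMonomial]

theorem laurentMonomial_sub (t : Fin n → G) (v w : Fin n → ℤ) :
    laurentMonomial t (v - w) = laurentMonomial t v / laurentMonomial t w := by
  rw [sub_eq_add_neg, laurentMonomial_add, laurentMonomial_neg, div_eq_mul_inv]

theorem laurentMonomial_mul_left (s t : Fin n → G) (v : Fin n → ℤ) :
    laurentMonomial (s * t) v = laurentMonomial s v * laurentMonomial t v := by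
  simp [laurentMonomial, mul_zpow, Finset.prod_mul_distrib]

theorem laurentMonomial_single (t : Fin n → G) (j : Fin n) (N : ℤ) :
    laurentMonomial t (Pi.single j N) = t j ^ N := by
  rw [laurentMonomial, Finset.prod_eq_single j] <;> simp +contextual

theorem map_laurentMonomial {H : Type*} [CommGroup H] (φ : G →* H) (t : Fin n → G)
    (v : Fin n → ℤ) : φ (laurentMonomial t v) = laurentMonomial (fun j => φ (t j)) v := by
  simp [laurentMonomial]

/-- The exponents whose Laurent monomial lies in a given subgroup. -/
def laurentMonomialExponents (t : Fin n → G) (H : Subgroup G) : AddSubgroup (Fin n → ℤ) where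
  carrier := {v | laurentMonomial t v ∈ H}
  zero_mem' := by simp [laurentMonomial_zero]
  add_mem' hv hw := by
    simpa only [Set.mem_ofPred_eq, laurentMonomial_add] using H.mul_mem hv hw
  neg_mem' hv := by
    simpa only [Set.mem_ofPred_eq, laurentMonomial_neg] using H.inv_mem hv

theorem mem_laurentMonomialExponents {t : Fin n → G} {H : Subgroup G} {v : Fin n → ℤ} :
    v ∈ laurentMonomialExponents t H ↔ laurentMonomial t v ∈ H := Iff.rfl

/-- The real span of the exponents of the monomial relations satisfied by `t`. -/
def relationSpan (t : Fin n → G) : Submodule ℝ (Fin n → ℝ) :=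
  Submodule.span ℝ ((fun (v : Fin n → ℤ) j => (v j : ℝ)) '' {v | laurentMonomial t v = 1})

/-- If the monomial relations of `t` have rank `r`, then some power of every coordinate of `t`
is a monomial in `n - r` of the coordinates. -/
theorem exists_zpow_mem_closure_image (t : Fin n → G) :
    ∃ S : Finset (Fin n), S.card + Module.finrank ℝ (relationSpan t) ≤ n ∧
      ∃ N : ℤ, N ≠ 0 ∧ ∀ j, t j ^ N ∈ Subgroup.closure (t '' S) := by
  classical
  set c : (Fin n → ℤ) → (Fin n → ℝ) := fun v j => (v j : ℝ) with hc
  have hcinj : Function.Injective c := fun v w h => by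
    ext j; exact Int.cast_injective (α := ℝ) (congrFun h j)
  obtain ⟨b, hbD, hbspan, hbli⟩ :=
    exists_linearIndependent ℝ (c '' {v | laurentMonomial t v = 1})
  let E : Set (Fin n → ℝ) := Set.range fun j => c (Pi.single j 1)
  obtain ⟨b', hb'T, hbb', hTb', hb'li⟩ :=
    exists_linearIndepOn_id_extension (t := b ∪ E) (show LinearIndepOn ℝ id b from hbli)
      Set.subset_union_left
  have hb'top : ⊤ ≤ Submodule.span ℝ (Set.range ((↑) : b' → Fin n → ℝ)) := by
    rw [Subtype.range_coe, ← (Pi.basisFun ℝ (Fin n)).span_eq, Submodule.span_le]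
    rintro _ ⟨j, rfl⟩
    refine hTb' (Or.inr ⟨j, ?_⟩)
    ext i
    simp [hc, Pi.single_apply]
  let B : Module.Basis b' ℝ (Fin n → ℝ) := Module.Basis.mk hb'li hb'top
  let e : Fin n ≃ b' := (Pi.basisFun ℝ (Fin n)).indexEquiv B
  have hfin : b'.Finite := Set.finite_coe_iff.mp (Finite.of_equiv _ e)
  have hcard : b'.ncard = n := by
    rw [← Nat.card_coe_set_eq, ← Nat.card_congr e, Nat.card_fin]
  have hbfin : b.Finite := hfin.subset hbb'
  have hrank : Module.finrank ℝ (relationSpan t) = b.ncard := by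
    have := hbfin.fintype
    rw [relationSpan, ← hbspan, finrank_span_set_eq_card hbli, Set.ncard_eq_toFinset_card']
  let S : Finset (Fin n) := Finset.univ.filter fun j => c (Pi.single j 1) ∈ b' \ b
  have hS : S.card ≤ (b' \ b).ncard := by
    rw [← Set.ncard_coe_finset]
    refine Set.ncard_le_ncard_of_injOn (fun j => c (Pi.single j 1)) ?_ ?_ (hfin.sdiff)
    · intro j hj
      simpa [S] using hj
    · intro i _ j _ h
      have := congrFun (hcinj h) i
      by_contra hij
      simp [hij] at this
  refine ⟨S, ?_, ?_⟩
  · have := Set.ncard_sdiff_add_ncard_of_subset hbb' hfin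
    omega
  · have hw : ∀ x : b', ∃ v : Fin n → ℤ, c v = x ∧
        v ∈ laurentMonomialExponents t (Subgroup.closure (t '' S)) := by
      rintro ⟨x, hx⟩
      by_cases hxb : x ∈ b
      · obtain ⟨v, hv, rfl⟩ := hbD hxb
        refine ⟨v, rfl, ?_⟩
        rw [mem_laurentMonomialExponents, show laurentMonomial t v = 1 from hv]
        exact one_mem _
      · obtain hx' | ⟨j, rfl⟩ := hb'T hx
        · exact absurd hx' hxb
        · refine ⟨Pi.single j 1, rfl, ?_⟩
          rw [mem_laurentMonomialExponents, laurentMonomial_single, zpow_one]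
          exact Subgroup.subset_closure ⟨j, by simpa [S] using ⟨hx, hxb⟩, rfl⟩
    choose w hw hwH using hw
    let W : Matrix (Fin n) (Fin n) ℤ := fun i => w (e i)
    have hdet : W.det ≠ 0 := by
      intro h0
      have hunit : IsUnit (W.map (Int.castRingHom ℝ)) := by
        rw [← Matrix.linearIndependent_rows_iff_isUnit]
        have : (W.map (Int.castRingHom ℝ)).row = (fun x : b' => (x : Fin n → ℝ)) ∘ e := by
          funext i
          exact hw (e i)
        rw [this]
        exact hb'li.comp _ e.injective
      rw [Matrix.isUnit_iff_isUnit_det, ← RingHom.mapMatrix_apply, ← RingHom.map_det, h0] at hunit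
      simp at hunit
    refine ⟨W.det, hdet, fun j => ?_⟩
    rw [← laurentMonomial_single, ← mem_laurentMonomialExponents]
    have : Pi.single j W.det = ∑ i, W.adjugate j i • W i := by
      funext l
      have := congrFun (congrFun W.adjugate_mul j) l
      rw [Matrix.mul_apply] at this
      simp only [Finset.sum_apply, Pi.smul_apply, smul_eq_mul, this, Matrix.smul_apply,
        Matrix.one_apply, Pi.single_apply]
      by_cases h : j = l <;> simp [h, eq_comm]
    rw [this]
    exact sum_mem fun i _ => zsmul_mem (hwH (e i)) _

end LaurentMonomial

/-- If the coefficient matrix of a `2 × 2` linear system lies in a subfield and is invertible,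
solutions with right hand side in the subfield lie in the subfield. -/
theorem Subfield.mem_of_mul_add_mul_mem {K : Type*} [Field K] (E : Subfield K)
    {x y c d c' d' : K} (hc : c ∈ E) (hd : d ∈ E) (hc' : c' ∈ E) (hd' : d' ∈ E)
    (hdet : c * d' - c' * d ≠ 0) (h : x * c + y * d ∈ E) (h' : x * c' + y * d' ∈ E) :
    x ∈ E ∧ y ∈ E := by
  have hdetE : c * d' - c' * d ∈ E := sub_mem (mul_mem hc hd') (mul_mem hc' hd)
  constructor
  · have : x = ((x * c + y * d) * d' - (x * c' + y * d') * d) / (c * d' - c' * d) := by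
      rw [eq_div_iff hdet]; ring
    rw [this]
    exact div_mem (sub_mem (mul_mem h hd') (mul_mem h' hd)) hdetE
  · have : y = ((x * c' + y * d') * c - (x * c + y * d) * c') / (c * d' - c' * d) := by
      rw [eq_div_iff hdet]; ring
    rw [this]
    exact div_mem (sub_mem (mul_mem h' hc) (mul_mem h hc')) hdetE

/-- A nontrivial torus element killed by the character `m` satisfies more monomial relations than
there are supports on which all its monomials agree. -/
theorem card_lt_finrank_relationSpan {G : Type*} [CommGroup G] {n : ℕ}
    (A : Fin n → Finset (Fin n → ℤ))
    (hG : AddSubgroup.closure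
        {v : Fin n → ℤ | ∃ i, ∃ a ∈ A i, ∃ b ∈ A i, v = a - b} = ⊤)
    (hpos : ∀ J : Finset (Fin n), J ≠ ∅ → J ⊂ Finset.univ →
      0 < colDefect (fun i => realize (A i)) J)
    {m : Fin n → ℤ} (hm : m ≠ 0) {t : Fin n → G} (ht : t ≠ 1) (htm : laurentMonomial t m = 1)
    (J : Finset (Fin n))
    (hJ : ∀ i ∈ J, ∀ a ∈ A i, ∀ b ∈ A i, laurentMonomial t a = laurentMonomial t b) :
    J.card < Module.finrank ℝ (relationSpan t) := by
  rcases eq_or_ne J ∅ with rfl | hne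
  · rw [Finset.card_empty, Module.finrank_pos_iff_exists_ne_zero]
    refine ⟨⟨fun j => (m j : ℝ), Submodule.subset_span ⟨m, htm, rfl⟩⟩, fun h => hm ?_⟩
    ext j
    exact Int.cast_injective (α := ℝ) (by simpa using congrFun (congrArg Subtype.val h) j)
  · have hproper : J ⊂ Finset.univ := by
      refine Finset.ssubset_univ_iff.mpr fun huniv => ht ?_
      have hle : AddSubgroup.closure
          {v : Fin n → ℤ | ∃ i, ∃ a ∈ A i, ∃ b ∈ A i, v = a - b} ≤
          laurentMonomialExponents t ⊥ := by
        rw [AddSubgroup.closure_le]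
        rintro _ ⟨i, a, ha, b, hb, rfl⟩
        rw [SetLike.mem_coe, mem_laurentMonomialExponents, Subgroup.mem_bot,
          laurentMonomial_sub, hJ i (huniv ▸ Finset.mem_univ i) a ha b hb, div_self']
      ext j
      have := hle (hG ▸ AddSubgroup.mem_top (Pi.single j 1))
      rwa [mem_laurentMonomialExponents, Subgroup.mem_bot, laurentMonomial_single,
        zpow_one] at this
    have hspan : colSpan (fun i => realize (A i)) (J : Set (Fin n)) ≤ relationSpan t := by
      refine Submodule.span_mono ?_
      rintro _ ⟨i, hi, _, ⟨a, ha, rfl⟩, _, ⟨b, hb, rfl⟩, rfl⟩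
      refine ⟨a - b, ?_, by ext j; simp⟩
      change laurentMonomial t (a - b) = 1
      rw [laurentMonomial_sub, hJ i hi a ha b hb, div_self']
    have h1 := hpos J hne hproper
    have h2 := Submodule.finrank_mono hspan
    rw [colDefect] at h1
    omega

/-- Over any field, a system with two distinct common zeros in the torus that agree under the
character `m` has algebraically dependent coefficients. -/
theorem not_algebraicIndependent_of_two_zeros {k K : Type*} [Field k] [Field K] [Algebra k K]
    {n : ℕ} (A : Fin n → Finset (Fin n → ℤ)) (hA : ∀ i, (A i).Nonempty)
    (hG : AddSubgroup.closure
        {v : Fin n → ℤ | ∃ i, ∃ a ∈ A i, ∃ b ∈ A i, v = a - b} = ⊤)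
    (hpos : ∀ J : Finset (Fin n), J ≠ ∅ → J ⊂ Finset.univ →
      0 < colDefect (fun i => realize (A i)) J)
    {m : Fin n → ℤ} (hm : m ≠ 0) (a : ((i : Fin n) × {x // x ∈ A i}) → K) {p q : Fin n → Kˣ}
    (hpq : p ≠ q) (hpqm : laurentMonomial p m = laurentMonomial q m)
    (hp : ∀ i, ∑ x : {x // x ∈ A i}, a ⟨i, x⟩ * ((laurentMonomial p x.1 : Kˣ) : K) = 0)
    (hq : ∀ i, ∑ x : {x // x ∈ A i}, a ⟨i, x⟩ * ((laurentMonomial q x.1 : Kˣ) : K) = 0) :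
    ¬ AlgebraicIndependent k a := by
  classical
  intro ha
  obtain ⟨t, rfl⟩ : ∃ t, q = p * t := ⟨p⁻¹ * q, by simp⟩
  have ht : t ≠ 1 := by
    rintro rfl
    simp at hpq
  have htm : laurentMonomial t m = 1 := by
    simpa [laurentMonomial_mul_left] using hpqm
  let J : Finset (Fin n) := Finset.univ.filter fun i =>
    ∀ a ∈ A i, ∀ b ∈ A i, laurentMonomial t a = laurentMonomial t b
  have hJlt : J.card < Module.finrank ℝ (relationSpan t) :=
    card_lt_finrank_relationSpan A hG hpos hm ht htm J fun i hi => by simpa [J] using hi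
  obtain ⟨S, hScard, N, hN, hS⟩ := exists_zpow_mem_closure_image t
  have hsel : ∀ i, ∃ x y : {x // x ∈ A i},
      i ∉ J → laurentMonomial t x.1 ≠ laurentMonomial t y.1 := by
    intro i
    by_cases hi : i ∈ J
    · obtain ⟨x, hx⟩ := hA i
      exact ⟨⟨x, hx⟩, ⟨x, hx⟩, fun h => absurd hi h⟩
    · have := hi
      simp only [J, Finset.mem_filter, Finset.mem_univ, true_and, not_forall] at this
      obtain ⟨x, hx, y, hy, hxy⟩ := this
      exact ⟨⟨x, hx⟩, ⟨y, hy⟩, fun _ => hxy⟩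
  choose x y hxy using hsel
  let R : Finset ((i : Fin n) × {x // x ∈ A i}) :=
    Finset.univ.image (fun i => ⟨i, x i⟩) ∪ Jᶜ.image (fun i => ⟨i, y i⟩)
  have hRcard : R.card = n + (n - J.card) := by
    rw [Finset.card_union_of_disjoint, Finset.card_image_of_injective,
      Finset.card_image_of_injective, Finset.card_compl, Finset.card_univ, Fintype.card_fin]
    · intro i j h
      exact congrArg Sigma.fst h
    · intro i j h
      exact congrArg Sigma.fst h
    · rw [Finset.disjoint_left]
      intro z hz hz'
      obtain ⟨i, -, rfl⟩ := Finset.mem_image.mp hz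
      obtain ⟨j, hj, h⟩ := Finset.mem_image.mp hz'
      obtain rfl : j = i := congrArg Sigma.fst h
      refine hxy j (Finset.mem_compl.mp hj) ?_
      rw [eq_of_heq (Sigma.mk.inj h).2]
  let s : Finset K := (Finset.univ.image fun j => (p j : K)) ∪ (S.image fun j => (t j : K)) ∪
    Rᶜ.image a
  have hscard : s.card ≤ n + S.card + (Fintype.card ((i : Fin n) × {x // x ∈ A i}) - R.card) := by
    refine (Finset.card_union_le _ _).trans (add_le_add ((Finset.card_union_le _ _).trans
      (add_le_add ?_ Finset.card_image_le)) ?_)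
    · exact Finset.card_image_le.trans (by simp)
    · exact Finset.card_image_le.trans (Finset.card_compl R).le
  let E := algebraicClosure (IntermediateField.adjoin k (s : Set K)) K
  have hsE : ∀ z ∈ s, z ∈ E := fun z hz =>
    E.algebraMap_mem ⟨z, IntermediateField.subset_adjoin k _ hz⟩
  let U : Subgroup Kˣ := E.toSubfield.toSubmonoid.units
  have hU : ∀ u : Kˣ, u ∈ U ↔ (u : K) ∈ E := fun u =>
    ⟨fun h => h.1, fun h => ⟨h, by simpa using E.inv_mem h⟩⟩
  have hpU : ∀ j, p j ∈ U := fun j => (hU _).mpr (hsE _ (by simp [s]))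
  have htU : ∀ j, t j ∈ U := by
    intro j
    have h1 : t j ^ N ∈ U := by
      refine (Subgroup.closure_le U).mpr ?_ (hS j)
      rintro _ ⟨i, hi, rfl⟩
      exact (hU _).mpr (hsE _ (Finset.mem_union_left _ (Finset.mem_union_right _
        (Finset.mem_image_of_mem _ hi))))
    have h2 : t j ^ N.natAbs ∈ U := by
      rw [← zpow_natCast]
      rcases Int.natAbs_eq N with h | h
      · rwa [← h]
      · rw [← inv_mem_iff, ← zpow_neg, ← h]
        exact h1
    rw [hU, mem_algebraicClosure_iff] at h2 ⊢
    rw [Units.val_pow_eq_pow_val] at h2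
    exact h2.of_pow (Int.natAbs_pos.mpr hN)
  have hmon : ∀ {u : Fin n → Kˣ}, (∀ j, u j ∈ U) → ∀ v, ((laurentMonomial u v : Kˣ) : K) ∈ E :=
    fun hu v => (hU _).mp (prod_mem fun j _ => zpow_mem (hu j) _)
  have hptU : ∀ j, (p * t) j ∈ U := fun j => mul_mem (hpU j) (htU j)
  have hrest : ∀ z, z ∉ R → a z ∈ E := fun z hz =>
    hsE _ (Finset.mem_union_right _ (Finset.mem_image_of_mem _ (Finset.mem_compl.mpr hz)))
  have hJE : ∀ i ∈ J, a ⟨i, x i⟩ ∈ E := by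
    intro i hi
    have h := hp i
    rw [← Finset.add_sum_erase _ _ (Finset.mem_univ (x i)), add_eq_zero_iff_eq_neg] at h
    have hmem : a ⟨i, x i⟩ * ((laurentMonomial p (x i).1 : Kˣ) : K) ∈ E := by
      rw [h]
      refine neg_mem (sum_mem fun z hz => mul_mem (hrest _ ?_) (hmon hpU _))
      have hz := Finset.ne_of_mem_erase hz
      simp only [R, Finset.mem_union, Finset.mem_image, not_or, not_exists, not_and]
      constructor
      · rintro j - h
        obtain rfl : j = i := congrArg Sigma.fst h
        exact hz (eq_of_heq (Sigma.mk.inj h).2).symm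
      · rintro j hj h
        obtain rfl : j = i := congrArg Sigma.fst h
        exact Finset.mem_compl.mp hj hi
    simpa using div_mem hmem (hmon hpU (x i).1)
  have hJcE : ∀ i ∉ J, a ⟨i, x i⟩ ∈ E ∧ a ⟨i, y i⟩ ∈ E := by
    intro i hi
    have hne : y i ≠ x i := fun h => hxy i hi (by rw [h])
    have key : ∀ u : Fin n → Kˣ, (∀ j, u j ∈ U) →
        ∑ z : {x // x ∈ A i}, a ⟨i, z⟩ * ((laurentMonomial u z.1 : Kˣ) : K) = 0 →
        a ⟨i, x i⟩ * ((laurentMonomial u (x i).1 : Kˣ) : K) +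
          a ⟨i, y i⟩ * ((laurentMonomial u (y i).1 : Kˣ) : K) ∈ E := by
      intro u hu h
      rw [← Finset.add_sum_erase _ _ (Finset.mem_univ (x i)),
        ← Finset.add_sum_erase _ _ (Finset.mem_erase.mpr ⟨hne, Finset.mem_univ (y i)⟩),
        ← add_assoc, add_eq_zero_iff_eq_neg] at h
      rw [h]
      refine neg_mem (sum_mem fun z hz => mul_mem (hrest _ ?_) (hmon hu _))
      simp only [Finset.mem_erase, Finset.mem_univ, and_true] at hz
      simp only [R, Finset.mem_union, Finset.mem_image, not_or, not_exists, not_and]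
      constructor
      · rintro j - h
        obtain rfl : j = i := congrArg Sigma.fst h
        exact hz.2 (eq_of_heq (Sigma.mk.inj h).2).symm
      · rintro j - h
        obtain rfl : j = i := congrArg Sigma.fst h
        exact hz.1 (eq_of_heq (Sigma.mk.inj h).2).symm
    refine E.toSubfield.mem_of_mul_add_mul_mem (hmon hpU _) (hmon hpU _) (hmon hptU _)
      (hmon hptU _) ?_ (key p hpU (hp i)) (key (p * t) hptU (hq i))
    simp only [laurentMonomial_mul_left, Units.val_mul]
    have : ((laurentMonomial t (y i).1 : Kˣ) : K) - laurentMonomial t (x i).1 ≠ 0 :=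
      sub_ne_zero.mpr fun h => hxy i hi (Units.ext h).symm
    convert mul_ne_zero (mul_ne_zero (laurentMonomial p (x i).1).ne_zero
      (laurentMonomial p (y i).1).ne_zero) this using 1
    ring
  have hall : ∀ z, a z ∈ E := by
    intro z
    by_cases hz : z ∈ R
    · rcases Finset.mem_union.mp hz with hz | hz
      · obtain ⟨i, -, rfl⟩ := Finset.mem_image.mp hz
        by_cases hi : i ∈ J
        · exact hJE i hi
        · exact (hJcE i hi).1
      · obtain ⟨i, hi, rfl⟩ := Finset.mem_image.mp hz
        exact (hJcE i (Finset.mem_compl.mp hi)).2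
    · exact hrest z hz
  have hle := ha.card_le_of_mem_algebraicClosure s hall
  have hRle := R.card_le_univ
  have hJle : J.card ≤ n := J.card_le_univ.trans (by simp)
  omega

/-- If every nonzero polynomial is nonzero at some member of a family of points of `k ^ σ`, then
some field-valued point of the ring of functions on the family makes the coordinates
algebraically independent. -/
theorem exists_algHom_algebraicIndependent {k σ V : Type*} [Field k] (c : V → σ → k)
    (h : ∀ F : MvPolynomial σ k, F ≠ 0 → ∃ v, MvPolynomial.eval (c v) F ≠ 0) :
    ∃ P : Ideal (V → k), ∃ _ : P.IsPrime,
      AlgebraicIndependent k fun i =>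
        IsScalarTower.toAlgHom k (V → k) (FractionRing ((V → k) ⧸ P)) fun v => c v i := by
  let ψ : MvPolynomial σ k →ₐ[k] (V → k) := MvPolynomial.aeval fun i v => c v i
  have hψ : ∀ F v, ψ F v = MvPolynomial.eval (c v) F := by
    intro F v
    have : (Pi.evalAlgHom k (fun _ : V => k) v).comp ψ = MvPolynomial.aeval (c v) := by
      ext i
      simp [ψ]
    exact DFunLike.congr_fun this F
  have hinj : ∀ F, F ≠ 0 → ψ F ≠ 0 := by
    intro F hF h0
    obtain ⟨v, hv⟩ := h F hF
    exact hv (by rw [← hψ, h0, Pi.zero_apply])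
  obtain ⟨P, hP, -, hdisj⟩ := Ideal.exists_le_prime_disjoint (⊥ : Ideal (V → k))
    ((nonZeroDivisors (MvPolynomial σ k)).map ψ) (by
      rw [Set.disjoint_left]
      rintro _ h0 ⟨F, hF, rfl⟩
      exact hinj F (nonZeroDivisors.ne_zero hF) h0)
  refine ⟨P, hP, ?_⟩
  rw [algebraicIndependent_iff]
  intro F hF
  by_contra hne
  have hcomp := MvPolynomial.comp_aeval_apply (fun i v => c v i)
    (IsScalarTower.toAlgHom k (V → k) (FractionRing ((V → k) ⧸ P))) F
  rw [← hcomp, show (MvPolynomial.aeval fun i v => c v i) F = ψ F from rfl,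
    IsScalarTower.toAlgHom_apply,
    IsScalarTower.algebraMap_apply (V → k) ((V → k) ⧸ P),
    FaithfulSMul.algebraMap_eq_zero_iff, Ideal.Quotient.algebraMap_eq,
    Ideal.Quotient.eq_zero_iff_mem] at hF
  exact Set.disjoint_left.mp hdisj hF ⟨F, mem_nonZeroDivisors_of_ne_zero hne, rfl⟩

/-- If `G(A) = ℤ^n` and every proper nonempty subset has positive defect, then
for any nontrivial character `χ(x) = x^m` the generic system has no two distinct roots `p, q`
with `χ(p) = χ(q)`. -/
theorem character_independence {n : ℕ} (hn : 1 ≤ n)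
    (A : Fin n → Finset (Fin n → ℤ)) (hA : ∀ i, (A i).Nonempty)
    (hG : AddSubgroup.closure
        {v : Fin n → ℤ | ∃ i, ∃ a ∈ A i, ∃ b ∈ A i, v = a - b} = ⊤)
    (hpos : ∀ J : Finset (Fin n), J ≠ ∅ → J ⊂ Finset.univ →
      0 < colDefect (fun i => realize (A i)) J)
    (m : Fin n → ℤ) (hm : m ≠ 0) :
    ∃ F : MvPolynomial ((i : Fin n) × {x // x ∈ A i}) ℂ, F ≠ 0 ∧
      ∀ f : ∀ i, {x // x ∈ A i} → ℂ,
        (∃ p q : Fin n → ℂˣ, p ≠ q ∧ mon p m = mon q m ∧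
          (∀ i, evalL (f i) p = 0) ∧ (∀ i, evalL (f i) q = 0)) →
        MvPolynomial.eval (fun v => f v.1 v.2) F = 0 := by
  by_contra! hno
  let V := {f : ∀ i, {x // x ∈ A i} → ℂ // ∃ p q : Fin n → ℂˣ, p ≠ q ∧ mon p m = mon q m ∧
    (∀ i, evalL (f i) p = 0) ∧ (∀ i, evalL (f i) q = 0)}
  obtain ⟨P, _, hind⟩ := exists_algHom_algebraicIndependent
    (fun (f : V) (z : (i : Fin n) × {x // x ∈ A i}) => f.1 z.1 z.2) fun F hF => by
      obtain ⟨f, hf, hne⟩ := hno F hF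
      exact ⟨⟨f, hf⟩, hne⟩
  choose p q hpq hpqm hp hq using fun f : V => f.2
  set φ := IsScalarTower.toAlgHom ℂ (V → ℂ) (FractionRing ((V → ℂ) ⧸ P))
  let φu : (V → ℂˣ) →* (FractionRing ((V → ℂ) ⧸ P))ˣ :=
    (Units.map (φ : (V → ℂ) →* FractionRing ((V → ℂ) ⧸ P))).comp
      MulEquiv.piUnits.symm.toMonoidHom
  have hφu : ∀ u : V → ℂˣ, (φu u : FractionRing ((V → ℂ) ⧸ P)) = φ fun f => (u f : ℂ) :=
    fun _ => rfl
  have hmonapply : ∀ (u : V → Fin n → ℂˣ) (v : Fin n → ℤ),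
      laurentMonomial (fun j f => u f j) v = fun f => mon (u f) v := by
    intro u v
    ext f
    simp [laurentMonomial, mon]
  have hzero : ∀ u : V → Fin n → ℂˣ, (∀ f i, evalL (f.1 i) (u f) = 0) → ∀ i,
      ∑ x : {x // x ∈ A i}, φ (fun f => f.1 i x) *
        ((laurentMonomial (fun j => φu fun f => u f j) x.1 : (FractionRing ((V → ℂ) ⧸ P))ˣ) :
          FractionRing ((V → ℂ) ⧸ P)) = 0 := by
    intro u hu i
    simp only [← map_laurentMonomial, hmonapply, hφu, ← map_mul, ← map_sum]
    convert map_zero φ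
    ext f
    rw [Finset.sum_apply]
    exact hu f i
  refine not_algebraicIndependent_of_two_zeros A hA hG hpos hm _
    (p := fun j => φu fun f => p f j) (q := fun j => φu fun f => q f j) ?_ ?_
    (hzero p hp) (hzero q hq) hind
  · intro heq
    choose j hj using fun f => Function.ne_iff.mp (hpq f)
    have hone : ∑ i, (fun f => if i = j f then ((p f i : ℂ) - q f i)⁻¹ else 0) *
        ((fun f => (p f i : ℂ)) - fun f => (q f i : ℂ)) = (1 : V → ℂ) := by
      ext f
      have : (p f (j f) : ℂ) - q f (j f) ≠ 0 := sub_ne_zero.mpr fun h => hj f (Units.ext h)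
      simp [ite_mul, inv_mul_cancel₀ this]
    have h1 := congrArg φ hone
    rw [map_one, map_sum] at h1
    refine one_ne_zero (h1.symm.trans (Finset.sum_eq_zero fun i _ => ?_))
    rw [map_mul, map_sub, ← hφu fun f => p f i, ← hφu fun f => q f i, congrFun heq i, sub_self,
      mul_zero]
  · simp only [← map_laurentMonomial, hmonapply, hpqm]
end
end
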